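/- For every k ∈ ℕ, the seminormed spaces H^k_𝔄(𝒜, X*) and H^k(𝒜/J, X*) are isometrically isomorphic, i.e., the k-th module cohomology of 𝒜 with coefficients in the dual module X* coincides with the k-th Hochschild cohomology of the quotient Banach algebra 𝒜/J with coefficients in X*. -/

import Mathlib

noncomputable section

/-- merged sequence -/
def mergeAt {A : Type*} [Mul A] {n : ℕ} (u : Fin (n + 1) → A) (j : Fin n) : Fin n → A :=
  fun i =>
    if i.val < j.val then u i.castSucc
    else if i = j then u j.castSucc * u j.succ
    else u i.succ

variable {A W : Type*}
  [NonUnitalNormedRing A] [NormedSpace ℂ A]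
  [NormedAddCommGroup W] [NormedSpace ℂ W]

/-- The space of bounded `n`-linear maps from `A × ⋯ × A` to `W` (Hochschild `n`-cochains). -/
abbrev Cochain (A W : Type*) [NonUnitalNormedRing A] [NormedSpace ℂ A]
    [NormedAddCommGroup W] [NormedSpace ℂ W] (n : ℕ) : Type _ :=
  ContinuousMultilinearMap ℂ (fun _ : Fin n => A) W

/-- The Hochschild coboundary of an `n`-cochain, w.r.t. the actions `lW`, `rW` of `A` on `W`. -/
def hDelta (lW : A →L[ℂ] W →L[ℂ] W) (rW : W →L[ℂ] A →L[ℂ] W) (n : ℕ)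
    (T : Cochain A W n) : (Fin (n + 1) → A) → W :=
  fun v =>
    lW (v 0) (T (Fin.tail v)) +
      (∑ i : Fin n, ((-1 : ℂ) ^ (i.val + 1)) • T (mergeAt v i)) +
      ((-1 : ℂ) ^ (n + 1)) • rW (T (Fin.init v)) (v (Fin.last n))

theorem hDelta_add (lW : A →L[ℂ] W →L[ℂ] W) (rW : W →L[ℂ] A →L[ℂ] W) (n : ℕ)
    (T S : Cochain A W n) (v : Fin (n + 1) → A) :
    hDelta lW rW n (T + S) v = hDelta lW rW n T v + hDelta lW rW n S v := by
  simp only [hDelta, ContinuousMultilinearMap.add_apply, map_add,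
    ContinuousLinearMap.add_apply, smul_add, Finset.sum_add_distrib]
  abel

theorem hDelta_smul (lW : A →L[ℂ] W →L[ℂ] W) (rW : W →L[ℂ] A →L[ℂ] W) (n : ℕ)
    (c : ℂ) (T : Cochain A W n) (v : Fin (n + 1) → A) :
    hDelta lW rW n (c • T) v = c • hDelta lW rW n T v := by
  simp only [hDelta, ContinuousMultilinearMap.smul_apply, map_smul,
    ContinuousLinearMap.smul_apply]
  rw [smul_add, smul_add, Finset.smul_sum]
  congr 1
  · congr 1
    exact Finset.sum_congr rfl fun i _ => smul_comm ((-1 : ℂ) ^ (i.val + 1)) c _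
  · exact smul_comm ((-1 : ℂ) ^ (n + 1)) c _

theorem hDelta_zero (lW : A →L[ℂ] W →L[ℂ] W) (rW : W →L[ℂ] A →L[ℂ] W) (n : ℕ)
    (v : Fin (n + 1) → A) : hDelta lW rW n (0 : Cochain A W n) v = 0 := by
  simp [hDelta]

variable (lW : A →L[ℂ] W →L[ℂ] W) (rW : W →L[ℂ] A →L[ℂ] W)
  (M : ∀ n : ℕ, Submodule ℂ (Cochain A W n))

/-- The space of `n`-cocycles lying in the admissible class `M` (e.g. `𝔄`-module cochains). -/
def cocycles (n : ℕ) : Submodule ℂ (Cochain A W n) where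
  carrier := {T | T ∈ M n ∧ ∀ v, hDelta lW rW n T v = 0}
  add_mem' := by
    rintro T S ⟨hT1, hT2⟩ ⟨hS1, hS2⟩
    exact ⟨(M n).add_mem hT1 hS1, fun v => by rw [hDelta_add, hT2 v, hS2 v, add_zero]⟩
  zero_mem' := ⟨(M n).zero_mem, fun v => hDelta_zero lW rW n v⟩
  smul_mem' := by
    rintro c T ⟨hT1, hT2⟩
    exact ⟨(M n).smul_mem c hT1, fun v => by rw [hDelta_smul, hT2 v, smul_zero]⟩

/-- The space of `(n+1)`-coboundaries of admissible `n`-cochains. -/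
def coboundaries (n : ℕ) : Submodule ℂ (Cochain A W (n + 1)) where
  carrier := {T | ∃ S, S ∈ M n ∧ ∀ v, T v = hDelta lW rW n S v}
  add_mem' := by
    rintro T T' ⟨S, hS, hTS⟩ ⟨S', hS', hTS'⟩
    exact ⟨S + S', (M n).add_mem hS hS', fun v => by
      rw [ContinuousMultilinearMap.add_apply, hTS v, hTS' v, hDelta_add]⟩
  zero_mem' := ⟨0, (M n).zero_mem, fun v => by
    rw [ContinuousMultilinearMap.zero_apply, hDelta_zero]⟩
  smul_mem' := by
    rintro c T ⟨S, hS, hTS⟩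
    exact ⟨c • S, (M n).smul_mem c hS, fun v => by
      rw [ContinuousMultilinearMap.smul_apply, hTS v, hDelta_smul]⟩

/-- The `(n+1)`-st cohomology space (of the complex of admissible cochains):
cocycles modulo coboundaries. -/
def cohomology (n : ℕ) :=
  ↥(cocycles lW rW M (n + 1)) ⧸
    (coboundaries lW rW M n).comap (cocycles lW rW M (n + 1)).subtype

instance (n : ℕ) : AddCommGroup (cohomology lW rW M n) :=
  Submodule.Quotient.addCommGroup _

instance (n : ℕ) : Module ℂ (cohomology lW rW M n) := Submodule.Quotient.module _

/-- The quotient seminorm on the cohomology space. -/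
def cohomSeminorm (n : ℕ) (c : cohomology lW rW M n) : ℝ :=
  ⨅ T : {T : ↥(cocycles lW rW M (n + 1)) // Submodule.Quotient.mk T = c},
    ‖((T : ↥(cocycles lW rW M (n + 1))) : Cochain A W (n + 1))‖

/-- The admissible class of `𝔄`-module cochains, for the right `𝔄`-action `ρ` on `A` and
the trivial (commutative) `𝔄`-action on the coefficients via the character `f`. -/
def moduleCochains {𝔄 : Type*} [NonUnitalNormedRing 𝔄] [NormedSpace ℂ 𝔄]
    (f : 𝔄 →L[ℂ] ℂ) (ρ : A →L[ℂ] 𝔄 →L[ℂ] A) (n : ℕ) : Submodule ℂ (Cochain A W n) where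
  carrier := {T | ∀ (v : Fin n → A) (i : Fin n) (α : 𝔄),
    T (Function.update v i (ρ (v i) α)) = f α • T v}
  add_mem' := by
    intro T S hT hS v i α
    simp only [ContinuousMultilinearMap.add_apply, hT v i α, hS v i α, smul_add]
  zero_mem' := by simp
  smul_mem' := by
    intro c T hT v i α
    simp only [ContinuousMultilinearMap.smul_apply, hT v i α]
    rw [smul_comm]

/-- A closed two-sided ideal of a (not necessarily unital) Banach algebra. -/
def IsClosedIdeal {A : Type*} [NonUnitalNormedRing A] [NormedSpace ℂ A]
    (J : Submodule ℂ A) : Prop :=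
  IsClosed (J : Set A) ∧ (∀ a x : A, x ∈ J → a * x ∈ J) ∧ ∀ x a : A, x ∈ J → x * a ∈ J

/-- `J` is the smallest closed two-sided ideal containing the set `S`. -/
def IsClosedIdealGeneratedBy {A : Type*} [NonUnitalNormedRing A] [NormedSpace ℂ A]
    (J : Submodule ℂ A) (S : Set A) : Prop :=
  IsClosedIdeal J ∧ S ⊆ (J : Set A) ∧
    ∀ K : Submodule ℂ A, IsClosedIdeal K → S ⊆ (K : Set A) → J ≤ K

/-- `X` is an `𝓛₁`-space. -/
def IsL1Space (X : Type*) [NormedAddCommGroup X] [NormedSpace ℂ X] : Prop :=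
  ∃ lam : ℝ, 1 < lam ∧ ∀ M : Submodule ℂ X, FiniteDimensional ℂ M →
    ∃ N : Submodule ℂ X, FiniteDimensional ℂ N ∧ M ≤ N ∧
      ∃ T : N ≃L[ℂ] PiLp 1 (fun _ : Fin (Module.finrank ℂ N) => ℂ),
        ‖(T : N →L[ℂ] PiLp 1 (fun _ : Fin (Module.finrank ℂ N) => ℂ))‖ *
          ‖(T.symm : PiLp 1 (fun _ : Fin (Module.finrank ℂ N) => ℂ) →L[ℂ] N)‖ ≤ lam



section Helpers

variable {𝔄 A B W : Type*}
    [NonUnitalNormedRing 𝔄] [NormedSpace ℂ 𝔄]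
    [NonUnitalNormedRing A] [NormedSpace ℂ A]
    [NormedRing B] [NormedAlgebra ℂ B]
    [NormedAddCommGroup W] [NormedSpace ℂ W]

/-- pullback of cochains -/
def pullC (q : A →L[ℂ] B) (n : ℕ) (S : Cochain B W n) : Cochain A W n :=
  S.compContinuousLinearMap (fun _ => q)

theorem pullC_apply (q : A →L[ℂ] B) (n : ℕ) (S : Cochain B W n) (v : Fin n → A) :
    pullC q n S v = S (fun i => q (v i)) := rfl

theorem bound_descend (q : A →L[ℂ] B)
    (hq : ∀ b : B, ∀ ε > 0, ∃ a, q a = b ∧ ‖a‖ ≤ ‖b‖ + ε)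
    (n : ℕ) (F : (Fin n → B) → ℝ) (C : ℝ) (hC : 0 ≤ C)
    (h : ∀ a : Fin n → A, F (fun i => q (a i)) ≤ C * ∏ i, ‖a i‖) (m : Fin n → B) :
    F m ≤ C * ∏ i, ‖m i‖ := by
  have ht : Filter.Tendsto (fun ε : ℝ => C * ∏ i, (‖m i‖ + ε)) (nhdsWithin 0 (Set.Ioi 0))
      (nhds (C * ∏ i, (‖m i‖ + 0))) := by
    apply Filter.Tendsto.mono_left _ nhdsWithin_le_nhds
    apply Continuous.tendsto (f := fun ε : ℝ => C * ∏ i, (‖m i‖ + ε))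
    fun_prop
  simp only [add_zero] at ht
  refine ge_of_tendsto ht ?_
  filter_upwards [self_mem_nhdsWithin] with ε hε
  choose a ha hn using fun i => hq (m i) ε hε
  have h1 := h a
  simp only [ha] at h1
  refine h1.trans (mul_le_mul_of_nonneg_left ?_ hC)
  exact Finset.prod_le_prod (fun i _ => norm_nonneg _) (fun i _ => hn i)

theorem pullC_norm (q : A →L[ℂ] B) (hq1 : ∀ a, ‖q a‖ ≤ ‖a‖)
    (hq : ∀ b : B, ∀ ε > 0, ∃ a, q a = b ∧ ‖a‖ ≤ ‖b‖ + ε)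
    (n : ℕ) (S : Cochain B W n) : ‖pullC q n S‖ = ‖S‖ := by
  apply le_antisymm
  · refine ContinuousMultilinearMap.opNorm_le_bound (norm_nonneg _) fun v => ?_
    rw [pullC_apply]
    refine (S.le_opNorm _).trans (mul_le_mul_of_nonneg_left ?_ (norm_nonneg _))
    exact Finset.prod_le_prod (fun i _ => norm_nonneg _) (fun i _ => hq1 _)
  · refine ContinuousMultilinearMap.opNorm_le_bound (norm_nonneg _) fun m => ?_
    exact bound_descend q hq n (fun m => ‖S m‖) _ (norm_nonneg _)
      (fun a => (pullC q n S).le_opNorm a) m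

theorem pullC_inj (q : A →L[ℂ] B) (hs : Function.Surjective q) (n : ℕ) :
    Function.Injective (pullC (W := W) q n) := by
  intro S S' h
  ext m
  choose a ha using fun i => hs (m i)
  have := congrArg (fun T => T a) h
  simpa [pullC_apply, ha] using this

theorem pullC_mem (f : 𝔄 →L[ℂ] ℂ) (ρ : A →L[ℂ] 𝔄 →L[ℂ] A) (q : A →L[ℂ] B)
    (hqρ : ∀ a α, q (ρ a α) = f α • q a) (n : ℕ) (S : Cochain B W n) :
    pullC q n S ∈ moduleCochains (W := W) f ρ n := by
  intro v i α
  rw [pullC_apply, pullC_apply]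
  have : (fun j => q (Function.update v i (ρ (v i) α) j)) =
      Function.update (fun j => q (v j)) i (f α • q (v i)) := by
    funext j
    by_cases hj : j = i
    · subst hj; simp [hqρ]
    · simp [hj]
  rw [this, S.map_update_smul]
  simp

theorem module_vanish (f : 𝔄 →L[ℂ] ℂ) (ρ : A →L[ℂ] 𝔄 →L[ℂ] A) (n : ℕ)
    (T : Cochain A W n) (hT : T ∈ moduleCochains (W := W) f ρ n)
    (v : Fin n → A) (i : Fin n) (x : A)
    (hx : x ∈ (Submodule.span ℂ
      {x : A | ∃ (a : A) (α : 𝔄), x = ρ a α - f α • a}).topologicalClosure) :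
    T (Function.update v i x) = 0 := by
  have : (Submodule.span ℂ
      {x : A | ∃ (a : A) (α : 𝔄), x = ρ a α - f α • a}).topologicalClosure ≤
      (T.toContinuousLinearMap v i).ker := by
    apply Submodule.topologicalClosure_minimal
    · rw [Submodule.span_le]
      rintro _ ⟨a, α, rfl⟩
      have h := hT (Function.update v i a) i α
      simp only [Function.update_self, Function.update_idem] at h
      change T (Function.update v i (ρ a α - f α • a)) = 0
      rw [T.map_update_sub, T.map_update_smul, h, sub_self]
    · exact ContinuousLinearMap.isClosed_ker _
  exact this hx

theorem module_congr (f : 𝔄 →L[ℂ] ℂ) (ρ : A →L[ℂ] 𝔄 →L[ℂ] A) (q : A →L[ℂ] B)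
    (hk : ∀ a, q a = 0 → a ∈ (Submodule.span ℂ
      {x : A | ∃ (a : A) (α : 𝔄), x = ρ a α - f α • a}).topologicalClosure) (n : ℕ)
    (T : Cochain A W n) (hT : T ∈ moduleCochains (W := W) f ρ n)
    (v w : Fin n → A) (h : ∀ i, q (v i) = q (w i)) : T v = T w := by
  have key : ∀ s : Finset (Fin n), T (s.piecewise v w) = T w := by
    intro s
    induction s using Finset.induction_on with
    | empty => simp
    | insert i s hi ih =>
      rw [Finset.piecewise_insert, ← ih]
      have h0 := module_vanish f ρ n T hT (s.piecewise v w) i (v i - w i)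
        (hk _ (by rw [map_sub, h, sub_self]))
      rw [T.map_update_sub, sub_eq_zero] at h0
      rw [h0]
      congr 1
      rw [Function.update_eq_self_iff]
      simp [hi]
  simpa using key Finset.univ

theorem pullC_surj (f : 𝔄 →L[ℂ] ℂ) (ρ : A →L[ℂ] 𝔄 →L[ℂ] A) (q : A →L[ℂ] B)
    (hq : ∀ b : B, ∀ ε > 0, ∃ a, q a = b ∧ ‖a‖ ≤ ‖b‖ + ε)
    (hk : ∀ a, q a = 0 → a ∈ (Submodule.span ℂ
      {x : A | ∃ (a : A) (α : 𝔄), x = ρ a α - f α • a}).topologicalClosure) (n : ℕ)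
    (T : Cochain A W n) (hT : T ∈ moduleCochains (W := W) f ρ n) :
    ∃ S : Cochain B W n, pullC q n S = T := by
  choose s hs _ using fun b => hq b 1 one_pos
  have hc := module_congr f ρ q hk n T hT
  let S0 : MultilinearMap ℂ (fun _ : Fin n => B) W :=
    { toFun := fun m => T (fun i => s (m i))
      map_update_add' := by
        intro _ m i x y
        have e : ∀ z, (fun j => s (Function.update m i z j)) =
            Function.update (fun j => s (m j)) i (s z) := by
          intro z; funext j
          by_cases hj : j = i
          · subst hj; simp
          · simp [hj]
        rw [e, e, e, ← T.map_update_add]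
        apply hc
        intro j
        by_cases hj : j = i
        · subst hj; simp [hs]
        · simp [hj]
      map_update_smul' := by
        intro _ m i c x
        have e : ∀ z, (fun j => s (Function.update m i z j)) =
            Function.update (fun j => s (m j)) i (s z) := by
          intro z; funext j
          by_cases hj : j = i
          · subst hj; simp
          · simp [hj]
        rw [e, e, ← T.map_update_smul]
        apply hc
        intro j
        by_cases hj : j = i
        · subst hj; simp [hs]
        · simp [hj] }
  have hS0 : ∀ a : Fin n → A, S0 (fun i => q (a i)) = T a := fun a =>
    hc _ _ fun i => hs _
  refine ⟨S0.mkContinuous ‖T‖ (bound_descend q hq n (fun m => ‖S0 m‖) _ (norm_nonneg _)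
    fun a => ?_), ?_⟩
  · simp only [hS0]
    exact T.le_opNorm a
  · ext a
    exact hS0 a

theorem pullC_delta (q : A →L[ℂ] B) (hq_mul : ∀ a b, q (a * b) = q a * q b)
    (lA : A →L[ℂ] W →L[ℂ] W) (rA : W →L[ℂ] A →L[ℂ] W)
    (lB : B →L[ℂ] W →L[ℂ] W) (rB : W →L[ℂ] B →L[ℂ] W)
    (hl : ∀ a w, lB (q a) w = lA a w) (hr : ∀ w a, rB w (q a) = rA w a)
    (n : ℕ) (S : Cochain B W n) (v : Fin (n + 1) → A) :
    hDelta lA rA n (pullC q n S) v = hDelta lB rB n S (fun i => q (v i)) := by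
  have hm : ∀ i : Fin n, (fun j => q (mergeAt v i j)) = mergeAt (fun j => q (v j)) i := by
    intro i
    funext j
    simp only [mergeAt]
    split_ifs <;> simp [hq_mul]
  simp only [hDelta, pullC_apply, hm, hl, hr]
  rfl

/-- pullback on cocycles -/
def pullZ (f : 𝔄 →L[ℂ] ℂ) (ρ : A →L[ℂ] 𝔄 →L[ℂ] A) (q : A →L[ℂ] B)
    (hqρ : ∀ a α, q (ρ a α) = f α • q a)
    (hq_mul : ∀ a b, q (a * b) = q a * q b)
    (lA : A →L[ℂ] W →L[ℂ] W) (rA : W →L[ℂ] A →L[ℂ] W)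
    (lB : B →L[ℂ] W →L[ℂ] W) (rB : W →L[ℂ] B →L[ℂ] W)
    (hl : ∀ a w, lB (q a) w = lA a w) (hr : ∀ w a, rB w (q a) = rA w a) (n : ℕ) :
    cocycles lB rB (fun j => (⊤ : Submodule ℂ (Cochain B W j))) n →ₗ[ℂ]
    cocycles lA rA (fun j => moduleCochains f ρ j) n where
  toFun S := ⟨pullC q n S.1, pullC_mem f ρ q hqρ n S.1, fun v => by
    rw [pullC_delta q hq_mul lA rA lB rB hl hr]; exact S.2.2 _⟩
  map_add' _ _ := rfl
  map_smul' _ _ := rfl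

theorem pullZ_bij (f : 𝔄 →L[ℂ] ℂ) (ρ : A →L[ℂ] 𝔄 →L[ℂ] A) (q : A →L[ℂ] B)
    (hqρ : ∀ a α, q (ρ a α) = f α • q a)
    (hq_mul : ∀ a b, q (a * b) = q a * q b)
    (lA : A →L[ℂ] W →L[ℂ] W) (rA : W →L[ℂ] A →L[ℂ] W)
    (lB : B →L[ℂ] W →L[ℂ] W) (rB : W →L[ℂ] B →L[ℂ] W)
    (hl : ∀ a w, lB (q a) w = lA a w) (hr : ∀ w a, rB w (q a) = rA w a) (n : ℕ)
    (hs : Function.Surjective q)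
    (hq : ∀ b : B, ∀ ε > 0, ∃ a, q a = b ∧ ‖a‖ ≤ ‖b‖ + ε)
    (hk : ∀ a, q a = 0 → a ∈ (Submodule.span ℂ
      {x : A | ∃ (a : A) (α : 𝔄), x = ρ a α - f α • a}).topologicalClosure) :
    Function.Bijective (pullZ f ρ q hqρ hq_mul lA rA lB rB hl hr n) := by
  constructor
  · intro S S' h
    exact Subtype.ext (pullC_inj q hs n (congrArg Subtype.val h))
  · rintro ⟨T, hT, hT0⟩
    obtain ⟨S, rfl⟩ := pullC_surj f ρ q hq hk n T hT
    refine ⟨⟨S, trivial, fun m => ?_⟩, rfl⟩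
    choose a ha using fun i => hs (m i)
    have := hT0 a
    rw [pullC_delta q hq_mul lA rA lB rB hl hr] at this
    simpa only [ha] using this

theorem main_aux (f : 𝔄 →L[ℂ] ℂ) (ρ : A →L[ℂ] 𝔄 →L[ℂ] A) (q : A →L[ℂ] B)
    (hqρ : ∀ a α, q (ρ a α) = f α • q a)
    (hq_mul : ∀ a b, q (a * b) = q a * q b)
    (lA : A →L[ℂ] W →L[ℂ] W) (rA : W →L[ℂ] A →L[ℂ] W)
    (lB : B →L[ℂ] W →L[ℂ] W) (rB : W →L[ℂ] B →L[ℂ] W)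
    (hl : ∀ a w, lB (q a) w = lA a w) (hr : ∀ w a, rB w (q a) = rA w a) (n : ℕ)
    (hs : Function.Surjective q)
    (hq1 : ∀ a, ‖q a‖ ≤ ‖a‖)
    (hq : ∀ b : B, ∀ ε > 0, ∃ a, q a = b ∧ ‖a‖ ≤ ‖b‖ + ε)
    (hk : ∀ a, q a = 0 → a ∈ (Submodule.span ℂ
      {x : A | ∃ (a : A) (α : 𝔄), x = ρ a α - f α • a}).topologicalClosure) :
    ∃ Φ : cohomology lA rA (fun j => moduleCochains f ρ j) n ≃ₗ[ℂ]
        cohomology lB rB (fun j => (⊤ : Submodule ℂ (Cochain B W j))) n,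
      ∀ c, cohomSeminorm lB rB (fun j => (⊤ : Submodule ℂ (Cochain B W j))) n (Φ c) =
        cohomSeminorm lA rA (fun j => moduleCochains f ρ j) n c := by
  let e := LinearEquiv.ofBijective _
    (pullZ_bij f ρ q hqρ hq_mul lA rA lB rB hl hr (n + 1) hs hq hk)
  have he : ∀ S, (e S).1 = pullC q (n + 1) S.1 := fun S => rfl
  have hcob : ∀ S, (e S).1 ∈ coboundaries lA rA (fun j => moduleCochains f ρ j) n ↔
      S.1 ∈ coboundaries lB rB (fun j => (⊤ : Submodule ℂ (Cochain B W j))) n := by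
    intro S
    rw [he]
    constructor
    · rintro ⟨R, hR, h⟩
      obtain ⟨R', rfl⟩ := pullC_surj f ρ q hq hk n R hR
      refine ⟨R', trivial, fun m => ?_⟩
      choose a ha using fun i => hs (m i)
      have := h a
      rw [pullC_delta q hq_mul lA rA lB rB hl hr, pullC_apply] at this
      simpa only [ha] using this
    · rintro ⟨R, -, h⟩
      refine ⟨pullC q n R, pullC_mem f ρ q hqρ n R, fun v => ?_⟩
      rw [pullC_delta q hq_mul lA rA lB rB hl hr, pullC_apply]
      exact h _
  have hmap : ((coboundaries lB rB (fun j => (⊤ : Submodule ℂ (Cochain B W j))) n).comap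
      (cocycles lB rB (fun j => (⊤ : Submodule ℂ (Cochain B W j))) (n + 1)).subtype).map
      (e : _ →ₗ[ℂ] _) =
      (coboundaries lA rA (fun j => moduleCochains f ρ j) n).comap
      (cocycles lA rA (fun j => moduleCochains f ρ j) (n + 1)).subtype := by
    ext T
    constructor
    · rintro ⟨S, hS, rfl⟩
      exact (hcob S).2 hS
    · intro hT
      obtain ⟨S, rfl⟩ := e.surjective T
      exact ⟨S, (hcob S).1 hT, rfl⟩
  let Ψ : cohomology lB rB (fun j => (⊤ : Submodule ℂ (Cochain B W j))) n ≃ₗ[ℂ]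
      cohomology lA rA (fun j => moduleCochains f ρ j) n :=
    Submodule.Quotient.equiv _ _ e hmap
  have hΨ : ∀ S, Ψ (Submodule.Quotient.mk S) = Submodule.Quotient.mk (e S) := fun S => rfl
  refine ⟨Ψ.symm, fun c => ?_⟩
  obtain ⟨d, rfl⟩ := Ψ.surjective c
  rw [LinearEquiv.symm_apply_apply]
  unfold cohomSeminorm
  refine Function.Surjective.iInf_congr
    (fun S => ⟨e S.1, by rw [← hΨ, S.2]⟩) ?_ ?_
  · rintro ⟨T, hT⟩
    obtain ⟨S, rfl⟩ := e.surjective T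
    exact ⟨⟨S, Ψ.injective (by rw [hΨ, hT])⟩, rfl⟩
  · intro S
    exact pullC_norm q hq1 hq (n + 1) S.1.1

end Helpers

/-- In the standing setting (trivial left `𝔄`-actions via the character
`f`, `J = J₀`, `A/J` unital and an `𝓛₁`-space, `X` a commutative Banach `A`-`𝔄`-bimodule
which is an `𝓛₁`-space), for every `k = k₀ + 1 ∈ ℕ` the seminormed spaces `H^k_𝔄(A, X*)`
and `H^k(A/J, X*)` are isometrically isomorphic: the `k`-th module cohomology of `A` with
coefficients in the dual module `X*` coincides with the `k`-th Hochschild cohomology of the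
quotient Banach algebra `A/J` with coefficients in `X*`. -/
theorem stmt_9
    {𝔄 A B X : Type*}
    [NonUnitalNormedRing 𝔄] [NormedSpace ℂ 𝔄] [IsScalarTower ℂ 𝔄 𝔄] [SMulCommClass ℂ 𝔄 𝔄]
    [CompleteSpace 𝔄]
    [NonUnitalNormedRing A] [NormedSpace ℂ A] [IsScalarTower ℂ A A] [SMulCommClass ℂ A A]
    [CompleteSpace A]
    [NormedRing B] [NormedAlgebra ℂ B] [CompleteSpace B]
    [NormedAddCommGroup X] [NormedSpace ℂ X] [CompleteSpace X]
    (f : 𝔄 →L[ℂ] ℂ) (hf_mul : ∀ α β, f (α * β) = f α * f β) (hf_ne : f ≠ 0)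
    (ρ : A →L[ℂ] 𝔄 →L[ℂ] A)
    (hρ_act : ∀ a α β, ρ (ρ a α) β = ρ a (α * β))
    (hρ_mul : ∀ a b α, ρ (a * b) α = a * ρ b α)
    (J : Submodule ℂ A)
    (hJ : IsClosedIdealGeneratedBy J {x | ∃ (a b : A) (α : 𝔄), x = ρ a α * b - f α • (a * b)})
    (hJ0 : J = (Submodule.span ℂ
      {x : A | ∃ (a : A) (α : 𝔄), x = ρ a α - f α • a}).topologicalClosure)
    (q : A →L[ℂ] B) (hq_mul : ∀ a b, q (a * b) = q a * q b)
    (hq_surj : Function.Surjective q)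
    (hq_ker : ∀ a, q a = 0 ↔ a ∈ J)
    (hq_norm : ∀ a, ‖q a‖ = ⨅ j : J, ‖a + (j : A)‖)
    -- `X`, a commutative Banach `A`-`𝔄`-bimodule with trivial left `𝔄`-action via `f`
    (lX : A →L[ℂ] X →L[ℂ] X) (rX : X →L[ℂ] A →L[ℂ] X)
    (hlX : ∀ a b x, lX (a * b) x = lX a (lX b x))
    (hrX : ∀ x a b, rX (rX x a) b = rX x (a * b))
    (hlrX : ∀ a x b, rX (lX a x) b = lX a (rX x b))
    (σX : X →L[ℂ] 𝔄 →L[ℂ] X)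
    (hσX : ∀ x α, σX x α = f α • x)
    (hcompL : ∀ a α x, f α • lX a x = lX (ρ a α) x)
    (hcompR : ∀ x a α, f α • rX x a = rX x (ρ a α))
    (hX1 : IsL1Space X) (hB1 : IsL1Space B)
    -- the canonical dual actions of `A` on `X* = X →L[ℂ] ℂ`
    (lXd : A →L[ℂ] (X →L[ℂ] ℂ) →L[ℂ] (X →L[ℂ] ℂ))
    (rXd : (X →L[ℂ] ℂ) →L[ℂ] A →L[ℂ] (X →L[ℂ] ℂ))
    (hlXd : ∀ (a : A) (φ : X →L[ℂ] ℂ) (x : X), lXd a φ x = φ (rX x a))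
    (hrXd : ∀ (φ : X →L[ℂ] ℂ) (a : A) (x : X), rXd φ a x = φ (lX a x))
    -- the induced actions of `B = A/J` on `X*` (well defined since `J·X* = X*·J = 0`)
    (lBd : B →L[ℂ] (X →L[ℂ] ℂ) →L[ℂ] (X →L[ℂ] ℂ))
    (rBd : (X →L[ℂ] ℂ) →L[ℂ] B →L[ℂ] (X →L[ℂ] ℂ))
    (hlBd : ∀ (a : A) (φ : X →L[ℂ] ℂ), lBd (q a) φ = lXd a φ)
    (hrBd : ∀ (φ : X →L[ℂ] ℂ) (a : A), rBd φ (q a) = rXd φ a)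
    -- the degree `k = k₀ + 1`
    (k₀ : ℕ) :
    -- conclusion: `H^k_𝔄(A, X*)` and `H^k(A/J, X*)` are isometrically isomorphic
    ∃ Φ : cohomology lXd rXd (fun j => moduleCochains f ρ j) k₀ ≃ₗ[ℂ]
        cohomology lBd rBd (fun j => (⊤ : Submodule ℂ (Cochain B (X →L[ℂ] ℂ) j))) k₀,
      ∀ c, cohomSeminorm lBd rBd (fun j => (⊤ : Submodule ℂ (Cochain B (X →L[ℂ] ℂ) j))) k₀
          (Φ c) =
        cohomSeminorm lXd rXd (fun j => moduleCochains f ρ j) k₀ c := by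
  have hbdd : ∀ a : A, BddBelow (Set.range fun j : J => ‖a + (j : A)‖) := fun a =>
    ⟨0, by rintro _ ⟨j, rfl⟩; exact norm_nonneg _⟩
  refine main_aux f ρ q ?_ hq_mul lXd rXd lBd rBd hlBd hrBd k₀ hq_surj ?_ ?_ ?_
  · intro a α
    have : q (ρ a α - f α • a) = 0 := by
      rw [hq_ker, hJ0]
      exact Submodule.le_topologicalClosure _ (Submodule.subset_span ⟨a, α, rfl⟩)
    rwa [map_sub, map_smul, sub_eq_zero] at this
  · intro a
    rw [hq_norm]
    simpa using ciInf_le (hbdd a) 0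
  · intro b ε hε
    obtain ⟨a, rfl⟩ := hq_surj b
    have : ⨅ j : J, ‖a + (j : A)‖ < ‖q a‖ + ε := by rw [← hq_norm]; linarith
    obtain ⟨j, hj⟩ := exists_lt_of_ciInf_lt this
    exact ⟨a + j, by rw [map_add, (hq_ker j).2 j.2, add_zero], hj.le⟩
  · intro a ha
    rw [← hJ0]
    exact (hq_ker a).1 ha
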